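/- Let d ≥ 3, let V be in the reverse Hölder class RH_q for some q > d/2, let ρ be the associated critical radius function, let 1 < p < ∞, θ > 0, α ∈ [0,1), and let w ∈ A_p^{ρ,θ}(ℝ^d). There exists C > 0 such that for every f ∈ BMO^α_{L,w}(ℝ^d), every x₀ ∈ ℝ^d, every r₀ with 0 < r₀ < ρ(x₀), and every n ∈ ℕ, one has |f_{B(x₀,2^{n+1}r₀)} − f_{B(x₀,2^n r₀)}| ≤ C 2^{n(d(p+α−1)+pθ)} |B(x₀,r₀)|^{α−1} w(B(x₀,r₀)) ‖f‖_{BMO^α_{L,w}}. -/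

import Mathlib

open MeasureTheory Metric

noncomputable section

/-- Euclidean space `ℝ^d`. -/
abbrev Rd (d : ℕ) := EuclideanSpace ℝ (Fin d)

/-- The Lebesgue measure `|B(x,r)|` of a ball, as a real number. -/
noncomputable def ballVol (d : ℕ) (x : Rd d) (r : ℝ) : ℝ :=
  (volume (ball x r)).toReal

/-- The integral `∫_{B(x,r)} g`. -/
noncomputable def ballInt (d : ℕ) (x : Rd d) (r : ℝ) (g : Rd d → ℝ) : ℝ :=
  ∫ y in ball x r, g y

/-- The average `|B(x,r)|⁻¹ ∫_{B(x,r)} g`. -/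
noncomputable def ballAvg (d : ℕ) (x : Rd d) (r : ℝ) (g : Rd d → ℝ) : ℝ :=
  (ballVol d x r)⁻¹ * ballInt d x r g

/-- `V` is a nonnegative, locally integrable, not a.e. zero function in the
reverse Hölder class `RH_q(ℝ^d)`. -/
def IsRH (d : ℕ) (q : ℝ) (V : Rd d → ℝ) : Prop :=
  (∀ x, 0 ≤ V x) ∧ LocallyIntegrable V volume ∧
  ¬ (∀ᵐ x ∂(volume : Measure (Rd d)), V x = 0) ∧
  ∃ C > 0, ∀ x r, 0 < r →
    (ballAvg d x r (fun y => V y ^ q)) ^ (1/q) ≤ C * ballAvg d x r V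

/-- The critical radius function `ρ(x) = sup{r > 0 : r^{2-d} ∫_{B(x,r)} V ≤ 1}`. -/
noncomputable def criticalRadius (d : ℕ) (V : Rd d → ℝ) (x : Rd d) : ℝ :=
  sSup {r : ℝ | 0 < r ∧ r ^ (2 - (d : ℝ)) * ballInt d x r V ≤ 1}

/-- The weight `w` belongs to the class `A_p^{ρ,θ}(ℝ^d)`. -/
def MemAp (d : ℕ) (p θ : ℝ) (ρ : Rd d → ℝ) (w : Rd d → ℝ) : Prop :=
  (∀ x, 0 < w x) ∧ Measurable w ∧ LocallyIntegrable w volume ∧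
  LocallyIntegrable (fun x => w x ^ (-(1/(p-1)))) volume ∧
  ∃ C > 0, ∀ x r, 0 < r →
    (((1 + r / ρ x) ^ θ * ballVol d x r)⁻¹ * ballInt d x r w) *
      (((1 + r / ρ x) ^ θ * ballVol d x r)⁻¹ *
        ballInt d x r (fun y => w y ^ (-(1/(p-1))))) ^ (p-1) ≤ C

/-- `C` is an admissible constant in the definition of `BMO^α_{L,w}` for `f`. -/
def BMOBound (d : ℕ) (α : ℝ) (ρ w f : Rd d → ℝ) (C : ℝ) : Prop :=
  (∀ x₀ r₀, 0 < r₀ → r₀ < ρ x₀ →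
    ballInt d x₀ r₀ (fun y => |f y - ballAvg d x₀ r₀ f|) ≤
      C * (ballVol d x₀ r₀ ^ α * ballInt d x₀ r₀ w)) ∧
  (∀ x₀ r₀, ρ x₀ ≤ r₀ →
    ballInt d x₀ r₀ (fun y => |f y|) ≤
      C * (ballVol d x₀ r₀ ^ α * ballInt d x₀ r₀ w))

/-- `f` belongs to the space `BMO^α_{L,w}(ℝ^d)`. -/
def MemBMO (d : ℕ) (α : ℝ) (ρ w f : Rd d → ℝ) : Prop :=
  LocallyIntegrable f volume ∧ ∃ C > 0, BMOBound d α ρ w f C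

/-- The norm `‖f‖_{BMO^α_{L,w}}`: the least admissible constant. -/
noncomputable def bmoNorm (d : ℕ) (α : ℝ) (ρ w f : Rd d → ℝ) : ℝ :=
  sInf {C : ℝ | 0 < C ∧ BMOBound d α ρ w f C}

theorem ballVol_pos (d : ℕ) (x : Rd d) {r : ℝ} (hr : 0 < r) : 0 < ballVol d x r :=
  ENNReal.toReal_pos (measure_ball_pos volume x hr).ne' measure_ball_lt_top.ne

theorem ballVol_mul (d : ℕ) (x : Rd d) {s : ℝ} (r : ℝ) (hs : 0 < s) :
    ballVol d x (s * r) = s ^ d * ballVol d x r := by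
  unfold ballVol
  rw [Measure.addHaar_ball_mul_of_pos volume x hs r, Measure.addHaar_ball_center volume x r,
    ENNReal.toReal_mul, ENNReal.toReal_ofReal (by positivity)]
  simp

theorem MeasureTheory.LocallyIntegrable.integrableOn_ball {d : ℕ} {g : Rd d → ℝ}
    (hg : LocallyIntegrable g volume) (x : Rd d) (r : ℝ) : IntegrableOn g (ball x r) volume :=
  (hg.integrableOn_isCompact (isCompact_closedBall x r)).mono_set ball_subset_closedBall

theorem ballInt_nonneg {d : ℕ} {g : Rd d → ℝ} (hg : ∀ y, 0 ≤ g y) (x : Rd d) (r : ℝ) :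
    0 ≤ ballInt d x r g :=
  setIntegral_nonneg measurableSet_ball fun y _ => hg y

theorem ballInt_pos {d : ℕ} {g : Rd d → ℝ} (hg : LocallyIntegrable g volume)
    (hpos : ∀ y, 0 < g y) (x : Rd d) {r : ℝ} (hr : 0 < r) : 0 < ballInt d x r g := by
  unfold ballInt
  rw [setIntegral_pos_iff_support_of_nonneg_ae (Filter.Eventually.of_forall fun y => (hpos y).le)
    (hg.integrableOn_ball x r)]
  have : Function.support g = Set.univ := by
    ext y; simp [(hpos y).ne']
  rw [this, Set.univ_inter]
  exact measure_ball_pos volume x hr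

theorem ballInt_mono_radius {d : ℕ} {g : Rd d → ℝ} (hg : LocallyIntegrable g volume)
    (hnn : ∀ y, 0 ≤ g y) (x : Rd d) {r R : ℝ} (hrR : r ≤ R) :
    ballInt d x r g ≤ ballInt d x R g :=
  setIntegral_mono_set (hg.integrableOn_ball x R) (Filter.Eventually.of_forall hnn)
    (ball_subset_ball hrR).eventuallyLE

/-- Hölder's inequality for a weight and its dual weight. -/
theorem ballVol_rpow_le {d : ℕ} {p : ℝ} (hp : 1 < p) {w : Rd d → ℝ} (hpos : ∀ y, 0 < w y)
    (hmeas : Measurable w) (hw : LocallyIntegrable w volume)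
    (hσ : LocallyIntegrable (fun y => w y ^ (-(1 / (p - 1)))) volume) (x : Rd d) (r : ℝ) :
    ballVol d x r ^ p ≤
      ballInt d x r w * ballInt d x r (fun y => w y ^ (-(1 / (p - 1)))) ^ (p - 1) := by
  have hp0 : 0 < p := by linarith
  have hp1 : 0 < p - 1 := by linarith
  have hpq : p.HolderConjugate (p / (p - 1)) := Real.HolderConjugate.conjExponent hp
  have hq0 : 0 < p / (p - 1) := by positivity
  have e1 : ∀ y, (w y ^ (1 / p)) ^ p = w y := fun y => by
    rw [← Real.rpow_mul (hpos y).le, one_div_mul_cancel hp0.ne', Real.rpow_one]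
  have e2 : ∀ y, (w y ^ (-(1 / p))) ^ (p / (p - 1)) = w y ^ (-(1 / (p - 1))) := fun y => by
    rw [← Real.rpow_mul (hpos y).le]
    congr 1
    field_simp
  have e3 : ∀ y, w y ^ (1 / p) * w y ^ (-(1 / p)) = 1 := fun y => by
    rw [← Real.rpow_add (hpos y)]; simp
  have m1 : MemLp (fun y => w y ^ (1 / p)) (ENNReal.ofReal p) (volume.restrict (ball x r)) := by
    rw [← integrable_norm_rpow_iff (hmeas.pow_const _).aestronglyMeasurable (by simpa using hp0)
      ENNReal.ofReal_ne_top, ENNReal.toReal_ofReal hp0.le]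
    refine (hw.integrableOn_ball x r).congr (Filter.Eventually.of_forall fun y => ?_)
    simp only [Real.norm_of_nonneg (Real.rpow_nonneg (hpos y).le _), e1]
  have m2 : MemLp (fun y => w y ^ (-(1 / p))) (ENNReal.ofReal (p / (p - 1)))
      (volume.restrict (ball x r)) := by
    rw [← integrable_norm_rpow_iff (hmeas.pow_const _).aestronglyMeasurable (by simpa using hq0)
      ENNReal.ofReal_ne_top, ENNReal.toReal_ofReal hq0.le]
    refine (hσ.integrableOn_ball x r).congr (Filter.Eventually.of_forall fun y => ?_)
    simp only [Real.norm_of_nonneg (Real.rpow_nonneg (hpos y).le _), e2]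
  have key := integral_mul_le_Lp_mul_Lq_of_nonneg hpq
    (Filter.Eventually.of_forall fun y => Real.rpow_nonneg (hpos y).le _)
    (Filter.Eventually.of_forall fun y => Real.rpow_nonneg (hpos y).le _) m1 m2
  simp only [e1, e2, e3] at key
  have hvol : ∫ _ in ball x r, (1 : ℝ) = ballVol d x r := by
    simp [ballVol, Measure.real]
  rw [hvol] at key
  have hW : 0 ≤ ∫ y in ball x r, w y := ballInt_nonneg (fun y => (hpos y).le) x r
  have hS : 0 ≤ ∫ y in ball x r, w y ^ (-(1 / (p - 1))) :=
    ballInt_nonneg (fun y => Real.rpow_nonneg (hpos y).le _) x r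
  have := Real.rpow_le_rpow ENNReal.toReal_nonneg key hp0.le
  rw [Real.mul_rpow (by positivity) (by positivity), ← Real.rpow_mul hW, ← Real.rpow_mul hS,
    one_div_mul_cancel hp0.ne', Real.rpow_one] at this
  have e4 : 1 / (p / (p - 1)) * p = p - 1 := by field_simp
  rwa [e4] at this

/-- Comparison of the masses which an `A_p^{ρ,θ}` weight gives to concentric balls. -/
theorem MemAp.exists_ballInt_le {d : ℕ} {p θ : ℝ} (hp : 1 < p) {ρ w : Rd d → ℝ}
    (hρ : ∀ x, 0 < ρ x) (hw : MemAp d p θ ρ w) :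
    ∃ C > 0, ∀ (x : Rd d) (r R : ℝ), 0 < r → r ≤ R →
      ballInt d x R w * ballVol d x r ^ p ≤
        C * ((1 + R / ρ x) ^ θ * ballVol d x R) ^ p * ballInt d x r w := by
  obtain ⟨hpos, hmeas, hwi, hσi, C, hC, hb⟩ := hw
  refine ⟨C, hC, fun x r R hr hrR => ?_⟩
  have hR : 0 < R := hr.trans_le hrR
  have hnn : ∀ y, 0 ≤ w y ^ (-(1 / (p - 1))) := fun y => Real.rpow_nonneg (hpos y).le _
  have hh := ballVol_rpow_le hp hpos hmeas hwi hσi x r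
  have hσ := ballInt_mono_radius hσi hnn x hrR
  have hb := hb x R hR
  have hσr := ballInt_nonneg hnn x r
  have hσR := ballInt_nonneg hnn x R
  have hWr := ballInt_nonneg (fun y => (hpos y).le) x r
  have hWR := ballInt_nonneg (fun y => (hpos y).le) x R
  have hA : 0 < (1 + R / ρ x) ^ θ * ballVol d x R :=
    mul_pos (Real.rpow_pos_of_pos (by have := hρ x; positivity) _) (ballVol_pos d x hR)
  set A := (1 + R / ρ x) ^ θ * ballVol d x R
  set S := ballInt d x R (fun y => w y ^ (-(1 / (p - 1))))
  have hb' : ballInt d x R w * S ^ (p - 1) ≤ C * A ^ p := by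
    rw [Real.mul_rpow (by positivity) hσR, Real.inv_rpow hA.le] at hb
    have hAp : A ^ p = A * A ^ (p - 1) := by
      rw [← Real.rpow_one_add' hA.le (by linarith)]; congr 1; ring
    have hA1 : 0 < A ^ (p - 1) := Real.rpow_pos_of_pos hA _
    calc ballInt d x R w * S ^ (p - 1)
        = (A⁻¹ * ballInt d x R w * ((A ^ (p - 1))⁻¹ * S ^ (p - 1))) * A ^ p := by
          rw [hAp]; field_simp
      _ ≤ C * A ^ p := by gcongr
  calc ballInt d x R w * ballVol d x r ^ p
      ≤ ballInt d x R w * (ballInt d x r w * S ^ (p - 1)) := by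
        refine mul_le_mul_of_nonneg_left (hh.trans ?_) hWR
        have : 0 ≤ p - 1 := by linarith
        gcongr
    _ = (ballInt d x R w * S ^ (p - 1)) * ballInt d x r w := by ring
    _ ≤ C * A ^ p * ballInt d x r w := by gcongr

theorem ballInt_abs_sub_ballAvg_le {d : ℕ} {f : Rd d → ℝ} (hf : LocallyIntegrable f volume)
    (x : Rd d) {r : ℝ} (hr : 0 < r) :
    ballInt d x r (fun y => |f y - ballAvg d x r f|) ≤ 2 * ballInt d x r (fun y => |f y|) := by
  have hv := ballVol_pos d x hr
  have hfi := hf.integrableOn_ball x r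
  have hc : IntegrableOn (fun _ : Rd d => |ballAvg d x r f|) (ball x r) volume :=
    integrableOn_const measure_ball_lt_top.ne
  have hle : ballInt d x r (fun y => |f y - ballAvg d x r f|) ≤
      ∫ y in ball x r, (|f y| + |ballAvg d x r f|) :=
    setIntegral_mono (hfi.sub (integrableOn_const measure_ball_lt_top.ne)).abs
      (hfi.abs.add hc) fun y => abs_sub _ _
  have hconst : ∫ _ in ball x r, |ballAvg d x r f| = ballVol d x r * |ballAvg d x r f| := by
    simp [ballVol, Measure.real]
  have havg : ballVol d x r * |ballAvg d x r f| ≤ ballInt d x r (fun y => |f y|) := by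
    rw [ballAvg, abs_mul, abs_of_pos (inv_pos.2 hv), mul_inv_cancel_left₀ hv.ne']
    exact abs_integral_le_integral_abs
  rw [integral_add hfi.abs hc, hconst] at hle
  change _ ≤ ballInt d x r (fun y => |f y|) + _ at hle
  linarith

theorem BMOBound.ballInt_abs_sub_ballAvg_le {d : ℕ} {α C : ℝ} {ρ w f : Rd d → ℝ}
    (h : BMOBound d α ρ w f C) (hC : 0 ≤ C) (hw : ∀ y, 0 ≤ w y)
    (hf : LocallyIntegrable f volume) (x : Rd d) {r : ℝ} (hr : 0 < r) :
    ballInt d x r (fun y => |f y - ballAvg d x r f|) ≤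
      2 * C * (ballVol d x r ^ α * ballInt d x r w) := by
  have hK : 0 ≤ C * (ballVol d x r ^ α * ballInt d x r w) :=
    mul_nonneg hC (mul_nonneg (Real.rpow_nonneg ENNReal.toReal_nonneg _) (ballInt_nonneg hw x r))
  rcases lt_or_ge r (ρ x) with hlt | hge
  · linarith [h.1 x r hr hlt]
  · linarith [h.2 x r hge, _root_.ballInt_abs_sub_ballAvg_le hf x hr]

theorem abs_ballAvg_sub_le {d : ℕ} {f : Rd d → ℝ} (hf : LocallyIntegrable f volume)
    (x : Rd d) {r R : ℝ} (hr : 0 < r) (hrR : r ≤ R) (c : ℝ) :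
    |c - ballAvg d x r f| ≤ (ballVol d x r)⁻¹ * ballInt d x R (fun y => |f y - c|) := by
  have hv := ballVol_pos d x hr
  have hg : LocallyIntegrable (fun y => f y - c) volume := hf.sub (locallyIntegrable_const c)
  have hint : ballInt d x r (fun y => f y - c) = ballInt d x r f - ballVol d x r * c := by
    unfold ballInt
    rw [integral_sub (hf.integrableOn_ball x r) (integrableOn_const measure_ball_lt_top.ne)]
    simp [ballVol, Measure.real]
  have heq : ballAvg d x r f - c = (ballVol d x r)⁻¹ * ballInt d x r (fun y => f y - c) := by
    rw [hint, ballAvg]; field_simp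
  rw [abs_sub_comm, heq, abs_mul, abs_of_pos (inv_pos.2 hv)]
  refine mul_le_mul_of_nonneg_left (le_trans abs_integral_le_integral_abs ?_) (inv_pos.2 hv).le
  exact setIntegral_mono_set (hg.integrableOn_ball x R).abs
    (Filter.Eventually.of_forall fun y => abs_nonneg _) (ball_subset_ball hrR).eventuallyLE

theorem le_mul_bmoNorm {d : ℕ} {α K X : ℝ} {ρ w f : Rd d → ℝ} (hf : MemBMO d α ρ w f)
    (hK : 0 < K) (h : ∀ C, 0 < C → BMOBound d α ρ w f C → X ≤ K * C) :
    X ≤ K * bmoNorm d α ρ w f := by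
  obtain ⟨-, C, hC, hb⟩ := hf
  rw [mul_comm, ← div_le_iff₀ hK]
  refine le_csInf ⟨C, hC, hb⟩ fun D hD => ?_
  rw [div_le_iff₀ hK, mul_comm]
  exact h D hD.1 hD.2

/-- Estimate for the difference of consecutive dyadic averages of `f ∈ BMO^α_{L,w}`:
`|f_{B(x₀,2^{n+1}r₀)} - f_{B(x₀,2^n r₀)}| ≤ C 2^{n(d(p+α-1)+pθ)} |B(x₀,r₀)|^{α-1} w(B(x₀,r₀)) ‖f‖`. -/
theorem statement17 (d : ℕ) (hd : 3 ≤ d) (q : ℝ) (hq : (d : ℝ) / 2 < q)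
    (V : Rd d → ℝ) (hV : IsRH d q V)
    (ρ : Rd d → ℝ) (hρ : ρ = criticalRadius d V) (hρpos : ∀ x, 0 < ρ x)
    (p θ α : ℝ) (hp : 1 < p) (hθ : 0 < θ) (hα : 0 ≤ α) (hα1 : α < 1)
    (w : Rd d → ℝ) (hw : MemAp d p θ ρ w) :
    ∃ C > 0, ∀ f : Rd d → ℝ, MemBMO d α ρ w f →
      ∀ (x₀ : Rd d) (r₀ : ℝ), 0 < r₀ → r₀ < ρ x₀ → ∀ n : ℕ,
        |ballAvg d x₀ (2 ^ (n+1) * r₀) f - ballAvg d x₀ (2 ^ n * r₀) f| ≤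
          C * 2 ^ ((n : ℝ) * ((d : ℝ) * (p + α - 1) + p * θ)) *
            ballVol d x₀ r₀ ^ (α - 1) * ballInt d x₀ r₀ w * bmoNorm d α ρ w f := by
  obtain ⟨C, hC, hdoubling⟩ := hw.exists_ballInt_le hp hρpos
  obtain ⟨hpos, -, hwi, -, -⟩ := hw
  have hp0 : 0 < p := by linarith
  refine ⟨2 ^ (d : ℝ) * 2 * C * 2 ^ ((d : ℝ) * (p + α - 1) + 2 * (p * θ)), by positivity,
    fun f hf x₀ r₀ hr₀ hr₀ρ n => ?_⟩
  have hv := ballVol_pos d x₀ hr₀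
  have hW := ballInt_pos hwi hpos x₀ hr₀
  refine le_mul_bmoNorm hf (by positivity) fun D hD hbd => ?_
  have hr : 0 < 2 ^ n * r₀ := by positivity
  have hR : 0 < 2 ^ (n + 1) * r₀ := by positivity
  have hr₀R : r₀ ≤ 2 ^ (n + 1) * r₀ := le_mul_of_one_le_left hr₀.le (one_le_pow₀ one_le_two)
  have hrR : 2 ^ n * r₀ ≤ 2 ^ (n + 1) * r₀ := by
    gcongr <;> norm_num
  have hvR := ballVol_pos d x₀ hR
  have hosc := hbd.ballInt_abs_sub_ballAvg_le hD.le (fun y => (hpos y).le) hf.1 x₀ hR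
  have hdiff := abs_ballAvg_sub_le hf.1 x₀ hr hrR (ballAvg d x₀ (2 ^ (n + 1) * r₀) f)
  have hdb := hdoubling x₀ r₀ (2 ^ (n + 1) * r₀) hr₀ hr₀R
  have hΨ : 1 + 2 ^ (n + 1) * r₀ / ρ x₀ ≤ (2 : ℝ) ^ ((n : ℝ) + 2) := by
    have h1 : r₀ / ρ x₀ ≤ 1 := (div_le_one (hρpos x₀)).2 hr₀ρ.le
    have h2 : (2 : ℝ) ^ ((n : ℝ) + 2) = 2 ^ (n + 1) * 2 := by
      rw [← pow_succ]; exact_mod_cast Real.rpow_natCast 2 (n + 2)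
    have h3 : (1 : ℝ) ≤ 2 ^ (n + 1) := one_le_pow₀ one_le_two
    rw [h2, mul_div_assoc]
    nlinarith
  have hvol : ballVol d x₀ (2 ^ (n + 1) * r₀) =
      2 ^ (((n : ℝ) + 1) * d) * ballVol d x₀ r₀ := by
    rw [ballVol_mul d x₀ r₀ (by positivity), ← pow_mul]
    congr 1
    rw [← Real.rpow_natCast]; push_cast; rfl
  have hvoln : ballVol d x₀ (2 ^ n * r₀) = 2 ^ ((n : ℝ) * d) * ballVol d x₀ r₀ := by
    rw [ballVol_mul d x₀ r₀ (by positivity), ← pow_mul]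
    congr 1
    rw [← Real.rpow_natCast]; push_cast; rfl
  have hρ0 := hρpos x₀
  have hmass : ballInt d x₀ (2 ^ (n + 1) * r₀) w ≤
      C * 2 ^ (((n : ℝ) + 2) * (θ * p) + ((n : ℝ) + 1) * d * p) * ballInt d x₀ r₀ w := by
    refine le_of_mul_le_mul_right (hdb.trans ?_) (Real.rpow_pos_of_pos hv p)
    calc C * ((1 + 2 ^ (n + 1) * r₀ / ρ x₀) ^ θ * ballVol d x₀ (2 ^ (n + 1) * r₀)) ^ p *
          ballInt d x₀ r₀ w
        ≤ C * (((2 : ℝ) ^ ((n : ℝ) + 2)) ^ θ * ballVol d x₀ (2 ^ (n + 1) * r₀)) ^ p *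
          ballInt d x₀ r₀ w := by gcongr
      _ = _ := by
        rw [hvol, Real.mul_rpow (by positivity) (by positivity),
          Real.mul_rpow (by positivity) hv.le, Real.rpow_add two_pos (((n : ℝ) + 2) * (θ * p)),
          ← Real.rpow_mul two_pos.le,
          ← Real.rpow_mul two_pos.le, ← Real.rpow_mul two_pos.le, mul_assoc ((n : ℝ) + 2)]
        ring
  refine hdiff.trans ((mul_le_mul_of_nonneg_left hosc (by rw [hvoln]; positivity)).trans ?_)
  calc (ballVol d x₀ (2 ^ n * r₀))⁻¹ * (2 * D * (ballVol d x₀ (2 ^ (n + 1) * r₀) ^ α *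
        ballInt d x₀ (2 ^ (n + 1) * r₀) w))
      ≤ (ballVol d x₀ (2 ^ n * r₀))⁻¹ * (2 * D * (ballVol d x₀ (2 ^ (n + 1) * r₀) ^ α *
        (C * 2 ^ (((n : ℝ) + 2) * (θ * p) + ((n : ℝ) + 1) * d * p) * ballInt d x₀ r₀ w))) := by
        have := ballVol_pos d x₀ hr
        gcongr
    _ = (2 ^ (-((n : ℝ) * d)) * 2 ^ (((n : ℝ) + 1) * d * α) *
          2 ^ (((n : ℝ) + 2) * (θ * p) + ((n : ℝ) + 1) * d * p)) *
        (2 * C * ballVol d x₀ r₀ ^ (α - 1) * ballInt d x₀ r₀ w * D) := by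
        rw [hvol, hvoln, Real.mul_rpow (by positivity) hv.le, ← Real.rpow_mul two_pos.le,
          Real.rpow_neg two_pos.le, Real.rpow_sub_one hv.ne', mul_inv]
        ring
    _ = (2 ^ (d : ℝ) * 2 ^ ((d : ℝ) * (p + α - 1) + 2 * (p * θ)) *
          2 ^ ((n : ℝ) * ((d : ℝ) * (p + α - 1) + p * θ))) *
        (2 * C * ballVol d x₀ r₀ ^ (α - 1) * ballInt d x₀ r₀ w * D) := by
        simp only [← Real.rpow_add two_pos]
        ring_nf
    _ = _ := by ring
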